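/- Let A be an involutive Hopf algebra over ℂ (a Hopf algebra with antipode S and a conjugate-linear involution * making it a *-algebra such that Δ(a*) = (*⊗*)(Δ a) and ε(a*) = conj(ε(a))). Let V be a complex vector space with a conjugate-linear involution *, let α: A ⊗ V → V be a left action and γ: V → A ⊗ V a left coaction of A on V satisfying (α(a ⊗ v))* = α((S a)* ⊗ v*) and γ(v*) = (*⊗*)(γ v) for all a ∈ A, v ∈ V. Let Ψ = (α ⊗ id_V) ∘ (id_A ⊗ τ) ∘ (γ ⊗ id_V): V ⊗ V → V ⊗ V. Then the conjugate-linear map σ: V ⊗ V → V ⊗ V determined by σ(v ⊗ w) = Ψ(w* ⊗ v*) is an involution: σ ∘ σ = id_{V⊗V}. -/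

import Mathlib

open scoped TensorProduct

/-- The conjugate-linear map `M ⊗ N → M ⊗ N`, `m ⊗ n ↦ m* ⊗ n*`. -/
noncomputable def starTensor₂ (M N : Type*) [AddCommGroup M] [Module ℂ M]
    [StarAddMonoid M] [StarModule ℂ M]
    [AddCommGroup N] [Module ℂ N] [StarAddMonoid N] [StarModule ℂ N] :
    M ⊗[ℂ] N →+ M ⊗[ℂ] N :=
  TensorProduct.liftAddHom
    { toFun := fun m =>
        { toFun := fun n => star m ⊗ₜ[ℂ] star n
          map_zero' := by simp
          map_add' := fun n₁ n₂ => by simp [star_add, TensorProduct.tmul_add]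
        }
      map_zero' := by ext n; simp
      map_add' := fun m₁ m₂ => by ext n; simp [star_add, TensorProduct.add_tmul]
    }
    (fun c m n => by
      simp only [AddMonoidHom.coe_mk, ZeroHom.coe_mk, star_smul]
      exact TensorProduct.smul_tmul _ _ _)

/-- The conjugate-linear map `V ⊗ V → V ⊗ V`, `v ⊗ w ↦ w* ⊗ v*`. -/
noncomputable def starSwap (V : Type*) [AddCommGroup V] [Module ℂ V]
    [StarAddMonoid V] [StarModule ℂ V] :
    V ⊗[ℂ] V →+ V ⊗[ℂ] V :=
  TensorProduct.liftAddHom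
    { toFun := fun v =>
        { toFun := fun w => star w ⊗ₜ[ℂ] star v
          map_zero' := by simp
          map_add' := fun w₁ w₂ => by simp [star_add, TensorProduct.add_tmul]
        }
      map_zero' := by ext w; simp
      map_add' := fun v₁ v₂ => by ext w; simp [star_add, TensorProduct.tmul_add]
    }
    (fun c v w => by
      simp only [AddMonoidHom.coe_mk, ZeroHom.coe_mk, star_smul]
      exact (TensorProduct.smul_tmul _ _ _).symm)

/-- The braiding `Ψ = (α ⊗ id) ∘ (id ⊗ τ) ∘ (γ ⊗ id) : V ⊗ V → V ⊗ V`. -/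
noncomputable def braidPsi {A V : Type*} [Ring A] [Bialgebra ℂ A]
    [AddCommGroup V] [Module ℂ V]
    (α : A ⊗[ℂ] V →ₗ[ℂ] V) (γ : V →ₗ[ℂ] A ⊗[ℂ] V) :
    V ⊗[ℂ] V →ₗ[ℂ] V ⊗[ℂ] V :=
  TensorProduct.map α LinearMap.id
    ∘ₗ (TensorProduct.assoc ℂ A V V).symm.toLinearMap
    ∘ₗ TensorProduct.map LinearMap.id (TensorProduct.comm ℂ V V).toLinearMap
    ∘ₗ (TensorProduct.assoc ℂ A V V).toLinearMap
    ∘ₗ TensorProduct.map γ LinearMap.id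

/-- The linear map `A ⊗ V → V ⊗ V`, `a ⊗ x ↦ α(a ⊗ v) ⊗ x`. -/
noncomputable def actOn {A V : Type*} [AddCommGroup A] [Module ℂ A] [AddCommGroup V] [Module ℂ V]
    (α : A ⊗[ℂ] V →ₗ[ℂ] V) (v : V) : A ⊗[ℂ] V →ₗ[ℂ] V ⊗[ℂ] V :=
  TensorProduct.map (α ∘ₗ (TensorProduct.mk ℂ A V).flip v) LinearMap.id

@[simp]
theorem actOn_tmul {A V : Type*} [AddCommGroup A] [Module ℂ A] [AddCommGroup V] [Module ℂ V]
    (α : A ⊗[ℂ] V →ₗ[ℂ] V) (v : V) (a : A) (x : V) :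
    actOn α v (a ⊗ₜ[ℂ] x) = α (a ⊗ₜ[ℂ] v) ⊗ₜ[ℂ] x := rfl

@[simp]
theorem starTensor₂_tmul {M N : Type*} [AddCommGroup M] [Module ℂ M]
    [StarAddMonoid M] [StarModule ℂ M]
    [AddCommGroup N] [Module ℂ N] [StarAddMonoid N] [StarModule ℂ N] (m : M) (n : N) :
    starTensor₂ M N (m ⊗ₜ[ℂ] n) = star m ⊗ₜ[ℂ] star n := rfl

@[simp]
theorem starSwap_tmul {V : Type*} [AddCommGroup V] [Module ℂ V]
    [StarAddMonoid V] [StarModule ℂ V] (v w : V) :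
    starSwap V (v ⊗ₜ[ℂ] w) = star w ⊗ₜ[ℂ] star v := rfl

theorem braidPsi_tmul {A V : Type*} [Ring A] [Bialgebra ℂ A] [AddCommGroup V] [Module ℂ V]
    (α : A ⊗[ℂ] V →ₗ[ℂ] V) (γ : V →ₗ[ℂ] A ⊗[ℂ] V) (u v : V) :
    braidPsi α γ (u ⊗ₜ[ℂ] v) = actOn α v (γ u) := by
  simp only [braidPsi, LinearMap.comp_apply, LinearEquiv.coe_coe, TensorProduct.map_tmul,
    LinearMap.id_apply]
  induction γ u using TensorProduct.induction_on with
  | zero => simp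
  | tmul a x => simp
  | add s t hs ht => simp only [TensorProduct.add_tmul, map_add, hs, ht]

/-- The linear map `A ⊗ (A ⊗ V) → A ⊗ V`, `a ⊗ (b ⊗ x) ↦ S(a) b ⊗ x`. -/
noncomputable def antipodeMul (A V : Type*) [Ring A] [HopfAlgebra ℂ A]
    [AddCommGroup V] [Module ℂ V] : A ⊗[ℂ] (A ⊗[ℂ] V) →ₗ[ℂ] A ⊗[ℂ] V :=
  TensorProduct.map (LinearMap.mul' ℂ A ∘ₗ (HopfAlgebra.antipode ℂ).rTensor A) LinearMap.id
    ∘ₗ (TensorProduct.assoc ℂ A A V).symm.toLinearMap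

@[simp]
theorem antipodeMul_tmul {A V : Type*} [Ring A] [HopfAlgebra ℂ A]
    [AddCommGroup V] [Module ℂ V] (a b : A) (x : V) :
    antipodeMul A V (a ⊗ₜ[ℂ] (b ⊗ₜ[ℂ] x)) = (HopfAlgebra.antipode ℂ a * b) ⊗ₜ[ℂ] x := rfl

theorem antipodeMul_assoc_comul {A V : Type*} [Ring A] [HopfAlgebra ℂ A]
    [AddCommGroup V] [Module ℂ V] (t : A ⊗[ℂ] V) :
    antipodeMul A V (TensorProduct.assoc ℂ A A V
        (TensorProduct.map (Coalgebra.comul (R := ℂ)) LinearMap.id t))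
      = (1 : A) ⊗ₜ[ℂ] TensorProduct.lid ℂ V
          (TensorProduct.map (Coalgebra.counit (R := ℂ)) LinearMap.id t) := by
  induction t using TensorProduct.induction_on with
  | zero => simp
  | tmul a x =>
    simp only [antipodeMul, LinearMap.comp_apply, LinearEquiv.coe_coe,
      LinearEquiv.symm_apply_apply, TensorProduct.map_tmul, LinearMap.id_apply,
      HopfAlgebra.mul_antipode_rTensor_comul_apply, TensorProduct.lid_tmul,
      Algebra.algebraMap_eq_smul_one, TensorProduct.smul_tmul]
  | add s t hs ht => simp only [map_add, hs, ht, TensorProduct.tmul_add]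

theorem braidPsi_starSwap_actOn {A V : Type*} [Ring A] [HopfAlgebra ℂ A] [StarRing A]
    [StarModule ℂ A] [AddCommGroup V] [Module ℂ V] [StarAddMonoid V] [StarModule ℂ V]
    (α : A ⊗[ℂ] V →ₗ[ℂ] V)
    (hαmul : ∀ (a b : A) (v : V), α ((a * b) ⊗ₜ[ℂ] v) = α (a ⊗ₜ[ℂ] α (b ⊗ₜ[ℂ] v)))
    (γ : V →ₗ[ℂ] A ⊗[ℂ] V)
    (hαstar : ∀ (a : A) (v : V),
      star (α (a ⊗ₜ[ℂ] v)) = α (star (HopfAlgebra.antipode (R := ℂ) a) ⊗ₜ[ℂ] star v))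
    (hγstar : ∀ v : V, γ (star v) = starTensor₂ A V (γ v)) (v : V) (t : A ⊗[ℂ] V) :
    braidPsi α γ (starSwap V (actOn α (star v) t))
      = actOn α v (starTensor₂ A V (antipodeMul A V (TensorProduct.map LinearMap.id γ t))) := by
  induction t using TensorProduct.induction_on with
  | zero => simp
  | tmul a x =>
    simp only [actOn_tmul, starSwap_tmul, braidPsi_tmul, hαstar, hγstar, star_star,
      TensorProduct.map_tmul, LinearMap.id_apply]
    induction γ x using TensorProduct.induction_on with
    | zero => simp
    | tmul b y => simp [hαmul]
    | add r s hr hs => simp only [map_add, TensorProduct.tmul_add, hr, hs]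
  | add s t hs ht => simp only [map_add, hs, ht]

/-- For an involutive Hopf algebra `A` over `ℂ`, an involutive `A`-module-comodule `V`
(with `(α(a ⊗ v))* = α((S a)* ⊗ v*)` and `γ ∘ * = (*⊗*) ∘ γ`), the conjugate-linear map
`σ(v ⊗ w) = Ψ(w* ⊗ v*)` on `V ⊗ V` is an involution: `σ ∘ σ = id`. -/
theorem star_tensor_is_involution
    {A V : Type*} [Ring A] [HopfAlgebra ℂ A] [StarRing A] [StarModule ℂ A]
    (hΔstar : ∀ a : A,
      Coalgebra.comul (R := ℂ) (star a) = starTensor₂ A A (Coalgebra.comul (R := ℂ) a))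
    (hεstar : ∀ a : A,
      Coalgebra.counit (R := ℂ) (star a) = starRingEnd ℂ (Coalgebra.counit (R := ℂ) a))
    [AddCommGroup V] [Module ℂ V] [StarAddMonoid V] [StarModule ℂ V]
    (α : A ⊗[ℂ] V →ₗ[ℂ] V)
    (hα1 : ∀ v : V, α ((1 : A) ⊗ₜ[ℂ] v) = v)
    (hαmul : ∀ (a b : A) (v : V), α ((a * b) ⊗ₜ[ℂ] v) = α (a ⊗ₜ[ℂ] α (b ⊗ₜ[ℂ] v)))
    (γ : V →ₗ[ℂ] A ⊗[ℂ] V)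
    (hγcounit : ∀ v : V,
      (TensorProduct.lid ℂ V)
        (TensorProduct.map (Coalgebra.counit (R := ℂ)) LinearMap.id (γ v)) = v)
    (hγcoassoc : ∀ v : V,
      TensorProduct.map LinearMap.id γ (γ v)
        = TensorProduct.assoc ℂ A A V
            (TensorProduct.map (Coalgebra.comul (R := ℂ)) LinearMap.id (γ v)))
    (hαstar : ∀ (a : A) (v : V),
      star (α (a ⊗ₜ[ℂ] v)) = α (star (HopfAlgebra.antipode (R := ℂ) a) ⊗ₜ[ℂ] star v))
    (hγstar : ∀ v : V, γ (star v) = starTensor₂ A V (γ v)) :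
    ∀ x : V ⊗[ℂ] V,
      braidPsi α γ (starSwap V (braidPsi α γ (starSwap V x))) = x := by
  intro x
  induction x using TensorProduct.induction_on with
  | zero => simp
  | tmul v w =>
    rw [starSwap_tmul, braidPsi_tmul, braidPsi_starSwap_actOn α hαmul γ hαstar hγstar,
      hγcoassoc, antipodeMul_assoc_comul, hγcounit]
    simp [hα1]
  | add s t hs ht => simp only [map_add, hs, ht]
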